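/- Let d ≥ 1, let γ⁰,…,γᵈ be Dirac matrices, m > 0, T > 0, and let F : ℂ^{d₀} → ℂ^{d₀} be holomorphic with complex derivative F′(u) ∈ M_{d₀}(ℂ). Suppose ψ : (−T,T) × ℝ^d → ℂ^{d₀} is twice continuously differentiable, 2π-periodic in each spatial variable, solves pointwise ∂²ψ/∂t² − Δψ + m²ψ = G(ψ, ∂ψ), where G(ψ,∂ψ) := m F(ψ) + i Σ_{j=1}^d γʲ F′(ψ) (∂ψ/∂xʲ) − i Σ_{j=1}^d γ⁰ F′(ψ) γ⁰ γʲ (∂ψ/∂xʲ) + m γ⁰ F′(ψ) γ⁰ ψ − γ⁰ F′(ψ) γ⁰ F(ψ), and satisfies the initial conditions ψ(0,·) = ψ₀ and (∂ψ/∂t)(0,·) = −γ⁰ Σ_{j=1}^d γʲ ∂ψ₀/∂xʲ − i m γ⁰ ψ₀ + i γ⁰ F(ψ₀). Then ψ solves the Dirac equation −i Σ_{μ=0}^d γ^μ ∂ψ/∂x^μ + m ψ = F(ψ) pointwise on (−T,T) × ℝ^d (with x⁰ = t). -/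

import Mathlib

open Matrix
open scoped BigOperators

noncomputable section

/-- The Minkowski metric `η` on indices `0, 1, …, d`. -/
def eta (d : ℕ) (μ ν : Fin (d + 1)) : ℝ :=
  if μ = ν then (if μ = (0 : Fin (d + 1)) then 1 else -1) else 0

/-- A family `γ⁰, γ¹, …, γᵈ` of Dirac matrices. -/
def IsDiracFamily (d d0 : ℕ) (γ : Fin (d + 1) → Matrix (Fin d0) (Fin d0) ℂ) : Prop :=
  ∀ μ ν : Fin (d + 1),
    γ μ * γ ν + γ ν * γ μ = ((2 * eta d μ ν : ℝ) : ℂ) • (1 : Matrix (Fin d0) (Fin d0) ℂ)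

/-- The partial derivative `∂ψ/∂t` (with respect to the variable `x⁰ = t`). -/
def ptderiv (d d0 : ℕ) (ψ : ℝ × (Fin d → ℝ) → Fin d0 → ℂ) (p : ℝ × (Fin d → ℝ)) :
    Fin d0 → ℂ :=
  fderiv ℝ ψ p (1, 0)

/-- The partial derivative `∂ψ/∂xʲ` in the `j`-th spatial direction. -/
def pxderiv (d d0 : ℕ) (j : Fin d) (ψ : ℝ × (Fin d → ℝ) → Fin d0 → ℂ)
    (p : ℝ × (Fin d → ℝ)) : Fin d0 → ℂ :=
  fderiv ℝ ψ p (0, Pi.single j 1)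

/-- The nonlinearity
`G(ψ,∂ψ) = m F(ψ) + i Σ γʲ F′(ψ) ∂ⱼψ − i Σ γ⁰ F′(ψ) γ⁰ γʲ ∂ⱼψ + m γ⁰ F′(ψ) γ⁰ ψ − γ⁰ F′(ψ) γ⁰ F(ψ)`. -/
def GTerm (d d0 : ℕ) (γ : Fin (d + 1) → Matrix (Fin d0) (Fin d0) ℂ) (m : ℝ)
    (F : (Fin d0 → ℂ) → Fin d0 → ℂ) (F' : (Fin d0 → ℂ) → Matrix (Fin d0) (Fin d0) ℂ)
    (ψ : ℝ × (Fin d → ℝ) → Fin d0 → ℂ) (p : ℝ × (Fin d → ℝ)) : Fin d0 → ℂ :=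
  (m : ℂ) • F (ψ p)
    + Complex.I • ∑ j : Fin d, (γ j.succ * F' (ψ p)).mulVec (pxderiv d d0 j ψ p)
    - Complex.I • ∑ j : Fin d, (γ 0 * F' (ψ p) * γ 0 * γ j.succ).mulVec (pxderiv d d0 j ψ p)
    + (m : ℂ) • (γ 0 * F' (ψ p) * γ 0).mulVec (ψ p)
    - (γ 0 * F' (ψ p) * γ 0).mulVec (F (ψ p))

/-- The derivative of an entire function of several complex variables is continuous. -/
theorem continuous_fderiv_of_differentiable_complex {E F : Type*} [NormedAddCommGroup E]
    [NormedSpace ℂ E] [FiniteDimensional ℂ E] [NormedAddCommGroup F] [NormedSpace ℂ F]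
    [CompleteSpace F] {f : E → F} (hf : Differentiable ℂ f) : Continuous (fderiv ℂ f) := by
  refine continuous_clm_apply.2 fun v ↦ ?_
  have key : ∀ u, fderiv ℂ f u v = (2 * Real.pi * Complex.I : ℂ)⁻¹ •
      ∮ z in C(0, 1), ((z - 0) ^ 2)⁻¹ • f (u + z • v) := fun u ↦ by
    have hline : ∀ z : ℂ, HasDerivAt (fun z : ℂ ↦ f (u + z • v)) (fderiv ℂ f (u + z • v) v) z :=
      fun z ↦ (hf _).hasFDerivAt.comp_hasDerivAt z
        (by simpa using ((hasDerivAt_id z).smul_const v).const_add u)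
    rw [Complex.two_pi_I_inv_smul_circleIntegral_sub_sq_inv_smul_of_differentiable isOpen_univ
      (Set.subset_univ _) (fun z _ ↦ (hline z).differentiableAt.differentiableWithinAt)
      (Metric.mem_ball_self one_pos), (hline 0).deriv]
    simp
  simp_rw [key, circleIntegral, sub_zero, deriv_circleMap]
  refine continuous_const.smul
    (intervalIntegral.continuous_parametric_intervalIntegral_of_continuous' ?_ _ _)
  have hc : Continuous (circleMap 0 1) := continuous_circleMap 0 1
  have hinv : Continuous fun p : E × ℝ ↦ (circleMap 0 1 p.2 ^ 2)⁻¹ :=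
    ((hc.comp continuous_snd).pow 2).inv₀ fun p ↦ pow_ne_zero 2 (circleMap_ne_center one_ne_zero)
  have hfc := hf.continuous
  simp only [Function.uncurry_def]
  fun_prop

/-- Finitely many pairwise anticommuting involutions are symmetric for a common inner product. -/
theorem exists_bilin_symmetric_of_anticommuting {E ι : Type*} [NormedAddCommGroup E]
    [NormedSpace ℝ E] [FiniteDimensional ℝ E] [Finite ι] (A : ι → E →L[ℝ] E)
    (hsq : ∀ i v, A i (A i v) = v) (hanti : ∀ i j, i ≠ j → ∀ v, A i (A j v) = -A j (A i v)) :
    ∃ b : E →L[ℝ] E →L[ℝ] ℝ, (∀ u v, b u v = b v u) ∧ (∀ v, v ≠ 0 → 0 < b v v) ∧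
      ∀ i u v, b (A i u) v = b u (A i v) := by
  classical
  have := Fintype.ofFinite ι
  suffices H : ∀ s : Finset ι, ∃ b : E →L[ℝ] E →L[ℝ] ℝ, (∀ u v, b u v = b v u) ∧
      (∀ v, v ≠ 0 → 0 < b v v) ∧ ∀ i ∈ s, ∀ u v, b (A i u) (A i v) = b u v by
    obtain ⟨b, hs, hp, hA⟩ := H Finset.univ
    refine ⟨b, hs, hp, fun i u v ↦ ?_⟩
    rw [← hA i (Finset.mem_univ i) (A i u) v, hsq]
  intro s
  induction s using Finset.induction_on with
  | empty =>
    let e : E →L[ℝ] EuclideanSpace ℝ (Fin (Module.finrank ℝ E)) := (toEuclidean (E := E))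
    refine ⟨(innerSL ℝ).bilinearComp e e,
      fun u v ↦ ?_, fun v hv ↦ ?_, by simp⟩
    · simpa using real_inner_comm _ _
    · have : e v ≠ 0 := by simpa [e] using hv
      simpa using real_inner_self_pos.2 this
  | insert i s hi ih =>
    obtain ⟨b, hs, hp, hA⟩ := ih
    refine ⟨b + b.bilinearComp (A i) (A i), fun u v ↦ ?_, fun v hv ↦ ?_, fun j hj u v ↦ ?_⟩
    · simp [hs u v, hs (A i u)]
    · have : A i v ≠ 0 := fun h ↦ hv (by rw [← hsq i v, h, map_zero])
      simpa using add_pos (hp v hv) (hp _ this)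
    · rcases Finset.mem_insert.1 hj with rfl | hj
      · simp [hsq, add_comm]
      · have hij : i ≠ j := fun h ↦ hi (h ▸ hj)
        simp [hanti i j hij, hA j hj]

/-- A positive definite bilinear form on a finite-dimensional space is coercive. -/
theorem exists_pos_mul_sq_norm_le_of_pos {E : Type*} [NormedAddCommGroup E]
    [NormedSpace ℝ E] [FiniteDimensional ℝ E] (b : E →L[ℝ] E →L[ℝ] ℝ)
    (hpos : ∀ v, v ≠ 0 → 0 < b v v) : ∃ c > 0, ∀ v, c * ‖v‖ ^ 2 ≤ b v v := by
  rcases subsingleton_or_nontrivial E with hE | hE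
  · exact ⟨1, one_pos, fun v ↦ by simp [Subsingleton.elim v 0]⟩
  have := FiniteDimensional.proper_real E
  obtain ⟨w, hw, hmin⟩ := (isCompact_sphere (0 : E) 1).exists_isMinOn
    (NormedSpace.sphere_nonempty.2 zero_le_one)
    (f := fun v ↦ b v v) (by fun_prop)
  have hw0 : w ≠ 0 := fun h ↦ by simp [h] at hw
  refine ⟨b w w, hpos w hw0, fun v ↦ ?_⟩
  rcases eq_or_ne v 0 with rfl | hv
  · simp
  have hn : 0 < ‖v‖ := norm_pos_iff.2 hv
  have h := hmin (a := ‖v‖⁻¹ • v) (by simp [norm_smul, hn.ne'])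
  simp only [Set.mem_ofPred_eq, map_smul, _root_.smul_apply, smul_eq_mul] at h
  calc b w w * ‖v‖ ^ 2 ≤ (‖v‖⁻¹ * (‖v‖⁻¹ * b v v)) * ‖v‖ ^ 2 := by gcongr
    _ = b v v := by field_simp

section Hyperbolic

open Set MeasureTheory

variable {d : ℕ} {E : Type*} [NormedAddCommGroup E] [NormedSpace ℝ E]

/-- The projection of `Fin (d + 1) → ℝ` onto time and space coordinates. -/
def timeSpace (d : ℕ) : (Fin (d + 1) → ℝ) →L[ℝ] ℝ × (Fin d → ℝ) :=
  (ContinuousLinearMap.proj 0).prod (ContinuousLinearMap.pi fun j ↦ ContinuousLinearMap.proj j.succ)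

@[simp]
theorem timeSpace_fst (y : Fin (d + 1) → ℝ) : (timeSpace d y).1 = y 0 := rfl

@[simp]
theorem timeSpace_snd (y : Fin (d + 1) → ℝ) (j : Fin d) : (timeSpace d y).2 j = y j.succ := rfl

theorem timeSpace_cons (t : ℝ) (x : Fin d → ℝ) :
    timeSpace d (Fin.cons t x : Fin (d + 1) → ℝ) = (t, x) := rfl

@[simp]
theorem timeSpace_single_zero : timeSpace d (Pi.single 0 1) = (1, 0) := by
  ext <;> simp

@[simp]
theorem timeSpace_single_succ (j : Fin d) :
    timeSpace d (Pi.single j.succ 1) = (0, Pi.single j 1) := by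
  ext i
  · simp
  · simp [Pi.single_apply]

theorem timeSpace_insertNth_succ_add (j : Fin d) (c L : ℝ) (x : Fin d → ℝ) :
    timeSpace d (j.succ.insertNth (c + L) x : Fin (d + 1) → ℝ) =
      timeSpace d (j.succ.insertNth c x : Fin (d + 1) → ℝ) + (0, Pi.single j L) := by
  have h : (j.succ.insertNth (c + L) x : Fin (d + 1) → ℝ) =
      j.succ.insertNth c x + Pi.single j.succ L := by
    ext i
    rcases Fin.eq_self_or_eq_succAbove j.succ i with rfl | ⟨k, rfl⟩ <;> simp
  rw [h, map_add]
  congr 1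
  ext i
  · simp
  · simp [Pi.single_apply]

/-- The energy method: on `[0, T)`, a space-periodic solution with zero initial data of a linear
symmetric hyperbolic system vanishes. -/
theorem symmetric_hyperbolic_eq_zero_of_nonneg [FiniteDimensional ℝ E]
    (b : E →L[ℝ] E →L[ℝ] ℝ) (hsymm : ∀ u v, b u v = b v u) (hpos : ∀ v, v ≠ 0 → 0 < b v v)
    (A : Fin d → E →L[ℝ] E) (hA : ∀ j u v, b (A j u) v = b u (A j v))
    {T L : ℝ} (hL : 0 < L) (B : ℝ × (Fin d → ℝ) → E →L[ℝ] E)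
    (hB : ContinuousOn B (Ioo (-T) T ×ˢ univ)) (Φ : ℝ × (Fin d → ℝ) → E)
    (hΦ : ∀ p ∈ Ioo (-T) T ×ˢ univ, DifferentiableAt ℝ Φ p)
    (hper : ∀ t x j, Φ (t, x + Pi.single j L) = Φ (t, x))
    (hpde : ∀ p ∈ Ioo (-T) T ×ˢ univ,
      fderiv ℝ Φ p (1, 0) = -∑ j, A j (fderiv ℝ Φ p (0, Pi.single j 1)) + B p (Φ p))
    (h0 : ∀ x, Φ (0, x) = 0) {τ : ℝ} (hτ : τ ∈ Ico 0 T) (x₀ : Fin d → ℝ) : Φ (τ, x₀) = 0 := by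
  obtain ⟨c, hc, hcb⟩ := exists_pos_mul_sq_norm_le_of_pos b hpos
  have hbnn : ∀ v, 0 ≤ b v v := fun v ↦ (by positivity : 0 ≤ c * ‖v‖ ^ 2).trans (hcb v)
  let lo : Fin (d + 1) → ℝ := Fin.cons 0 x₀
  let hi : Fin (d + 1) → ℝ := Fin.cons τ fun j ↦ x₀ j + L
  have hle : lo ≤ hi := fun i ↦ by
    refine Fin.cases ?_ (fun j ↦ ?_) i
    · simpa [lo, hi] using hτ.1
    · simpa [lo, hi] using hL.le
  let l := timeSpace d
  have hmaps : MapsTo l (Icc lo hi) (Ioo (-T) T ×ˢ univ) := fun y hy ↦ by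
    have h1 : 0 ≤ y 0 := hy.1 0
    have h2 : y 0 ≤ τ := hy.2 0
    have := hτ.2
    exact ⟨⟨by simp [l]; linarith, by simp [l]; linarith⟩, mem_univ _⟩
  have hΦc : ContinuousOn (fun y ↦ Φ (l y)) (Icc lo hi) := fun y hy ↦
    ((hΦ _ (hmaps hy)).continuousAt.comp l.continuous.continuousAt).continuousWithinAt
  have hBc : ContinuousOn (fun y ↦ B (l y)) (Icc lo hi) := hB.comp l.continuous.continuousOn hmaps
  obtain ⟨M, hM⟩ := isCompact_Icc.exists_bound_of_continuousOn hBc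
  have hM0 : 0 ≤ M := (norm_nonneg _).trans (hM lo (left_mem_Icc.2 hle))
  let K := 2 * ‖b‖ * M / c
  have hK : ∀ y ∈ Icc lo hi, 2 * b (Φ (l y)) (B (l y) (Φ (l y))) ≤ K * b (Φ (l y)) (Φ (l y)) := by
    intro y hy
    set v := Φ (l y)
    calc 2 * b v (B (l y) v) ≤ 2 * (‖b‖ * ‖v‖ * (‖B (l y)‖ * ‖v‖)) := by
          have h1 := (le_abs_self _).trans (b.le_opNorm₂ v (B (l y) v))
          have h2 := (B (l y)).le_opNorm v
          have h3 : ‖b‖ * ‖v‖ * ‖B (l y) v‖ ≤ ‖b‖ * ‖v‖ * (‖B (l y)‖ * ‖v‖) := by gcongr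
          linarith
      _ ≤ 2 * (‖b‖ * ‖v‖ * (M * ‖v‖)) := by gcongr; exact hM y hy
      _ = K * (c * ‖v‖ ^ 2) := by simp only [K]; field_simp
      _ ≤ K * b v v := by gcongr; exact hcb v
  let A' : Fin (d + 1) → E →L[ℝ] E := Fin.cons (ContinuousLinearMap.id ℝ E) A
  have hA' : ∀ i u v, b (A' i u) v = b u (A' i v) := fun i u v ↦ by
    refine Fin.cases ?_ (fun j ↦ ?_) i
    · simp [A']
    · simpa [A'] using hA j u v
  let f : Fin (d + 1) → (Fin (d + 1) → ℝ) → ℝ := fun i y ↦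
    Real.exp (-K * y 0) * b (Φ (l y)) (A' i (Φ (l y)))
  let Φ' : (Fin (d + 1) → ℝ) → (Fin (d + 1) → ℝ) →L[ℝ] E := fun y ↦ (fderiv ℝ Φ (l y)).comp l
  have hΦ' : ∀ y ∈ Icc lo hi, HasFDerivAt (fun y ↦ Φ (l y)) (Φ' y) y := fun y hy ↦
    (hΦ _ (hmaps hy)).hasFDerivAt.comp y l.hasFDerivAt
  let w' : (Fin (d + 1) → ℝ) → (Fin (d + 1) → ℝ) →L[ℝ] ℝ := fun y ↦
    Real.exp (-K * y 0) • (-K) • ContinuousLinearMap.proj 0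
  have hw' : ∀ y, HasFDerivAt (fun y : Fin (d + 1) → ℝ ↦ Real.exp (-K * y 0)) (w' y) y :=
    fun y ↦ ((ContinuousLinearMap.proj (R := ℝ) (φ := fun _ : Fin (d + 1) ↦ ℝ)
      0).hasFDerivAt.const_mul (-K)).exp
  let f' : Fin (d + 1) → (Fin (d + 1) → ℝ) → (Fin (d + 1) → ℝ) →L[ℝ] ℝ := fun i y ↦
    Real.exp (-K * y 0) • (b.precompR _ (Φ (l y)) ((A' i).comp (Φ' y)) +
      b.precompL _ (Φ' y) (A' i (Φ (l y)))) + b (Φ (l y)) (A' i (Φ (l y))) • w' y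
  have hf' : ∀ i, ∀ y ∈ Icc lo hi, HasFDerivAt (f i) (f' i y) y := fun i y hy ↦
    (hw' y).mul (b.hasFDerivAt_of_bilinear (hΦ' y hy) ((A' i).hasFDerivAt.comp y (hΦ' y hy)))
  have hdiv : ∀ y ∈ Icc lo hi, ∑ i, f' i y (Pi.single i 1) = Real.exp (-K * y 0) *
      (2 * b (Φ (l y)) (B (l y) (Φ (l y))) - K * b (Φ (l y)) (Φ (l y))) := fun y hy ↦ by
    have h1 : ∀ i, f' i y (Pi.single i 1) = Real.exp (-K * y 0) *
        (2 * b (Φ (l y)) (A' i (Φ' y (Pi.single i 1)))) +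
        b (Φ (l y)) (A' i (Φ (l y))) * w' y (Pi.single i 1) := fun i ↦ by
      simp only [f', _root_.add_apply, _root_.smul_apply, smul_eq_mul, ContinuousLinearMap.precompR_apply,
        ContinuousLinearMap.precompL_apply, ContinuousLinearMap.compL_apply,
        ContinuousLinearMap.comp_apply]
      rw [← hA' i (Φ' y _), hsymm (A' i (Φ' y _))]
      ring
    have h2 := hpde _ (hmaps hy)
    have h3 : Φ' y (Pi.single 0 1) =
        -∑ j : Fin d, A j (Φ' y (Pi.single j.succ 1)) + B (l y) (Φ (l y)) := by
      simpa [Φ', l] using h2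
    have hw0 : w' y (Pi.single 0 1) = -(K * Real.exp (-K * y 0)) := by
      simp [w', mul_comm]
    have hws : ∀ j : Fin d, w' y (Pi.single j.succ 1) = 0 := fun j ↦ by simp [w']
    simp only [h1, Fin.sum_univ_succ, hw0, hws, A', Fin.cons_zero, Fin.cons_succ,
      ContinuousLinearMap.id_apply, h3, map_add, map_neg, map_sum, mul_zero, add_zero,
      ← Finset.mul_sum]
    ring
  have hdivc : ContinuousOn (fun y ↦ Real.exp (-K * y 0) *
      (2 * b (Φ (l y)) (B (l y) (Φ (l y))) - K * b (Φ (l y)) (Φ (l y)))) (Icc lo hi) :=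
    have hb := b.continuous.comp_continuousOn hΦc
    (by fun_prop : Continuous fun y : Fin (d + 1) → ℝ ↦ Real.exp (-K * y 0)).continuousOn.mul
      ((continuousOn_const.mul (hb.clm_apply (hBc.clm_apply hΦc))).sub
        (continuousOn_const.mul (hb.clm_apply hΦc)))
  have hflux := integral_divergence_of_hasFDerivAt_off_countable' lo hi hle f f' ∅ countable_empty
    (fun i y hy ↦ (hf' i y hy).continuousAt.continuousWithinAt)
    (fun y hy i ↦ hf' i y ⟨fun j ↦ (hy.1 j trivial).1.le, fun j ↦ (hy.1 j trivial).2.le⟩)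
    (hdivc.integrableOn_Icc.congr_fun (fun y hy ↦ (hdiv y hy).symm) measurableSet_Icc)
  have hneg : ∫ y in Icc lo hi, ∑ i, f' i y (Pi.single i 1) ≤ 0 := by
    refine setIntegral_nonpos measurableSet_Icc fun y hy ↦ ?_
    rw [hdiv y hy]
    exact mul_nonpos_of_nonneg_of_nonpos (Real.exp_pos _).le (sub_nonpos.2 (hK y hy))
  have hside : ∀ (j : Fin d) (x : Fin d → ℝ),
      f j.succ (j.succ.insertNth (hi j.succ) x) = f j.succ (j.succ.insertNth (lo j.succ) x) := by
    intro j x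
    have h1 : l (j.succ.insertNth (hi j.succ) x) =
        l (j.succ.insertNth (lo j.succ) x) + (0, Pi.single j L) :=
      timeSpace_insertNth_succ_add j (x₀ j) L x
    have h2 : Φ (l (j.succ.insertNth (hi j.succ) x)) = Φ (l (j.succ.insertNth (lo j.succ) x)) := by
      rw [h1]
      convert hper (l (j.succ.insertNth (lo j.succ) x)).1 (l (j.succ.insertNth (lo j.succ) x)).2 j
        using 2
      ext <;> simp
    have h3 : (j.succ.insertNth (hi j.succ) x : Fin (d + 1) → ℝ) 0 =
        (j.succ.insertNth (lo j.succ) x : Fin (d + 1) → ℝ) 0 := by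
      simpa [l] using congrArg Prod.fst h1
    simp only [f, h2, h3]
  have hbot : ∀ x : Fin d → ℝ, f 0 (Fin.insertNth 0 (lo 0) x) = 0 := fun x ↦ by
    have : l (Fin.insertNth 0 (lo 0) x) = (0, x) := by
      rw [Fin.insertNth_zero']; exact timeSpace_cons 0 x
    simp only [f, this, h0, map_zero, mul_zero]
  have htop : ∀ x : Fin d → ℝ, f 0 (Fin.insertNth 0 (hi 0) x) =
      Real.exp (-K * τ) * b (Φ (τ, x)) (Φ (τ, x)) := fun x ↦ by
    have : l (Fin.insertNth 0 (hi 0) x) = (τ, x) := by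
      rw [Fin.insertNth_zero']; exact timeSpace_cons τ x
    simp only [f, this]; simp [A', hi]
  rw [Fin.sum_univ_succ] at hflux
  simp only [hside, sub_self, Finset.sum_const_zero, add_zero, hbot, htop, integral_zero,
    sub_zero] at hflux
  have hlo : lo ∘ (0 : Fin (d + 1)).succAbove = x₀ := by ext; simp [lo]
  have hhi : hi ∘ (0 : Fin (d + 1)).succAbove = fun j ↦ x₀ j + L := by ext; simp [hi]
  rw [hlo, hhi] at hflux
  have hcont : Continuous fun x ↦ Real.exp (-K * τ) * b (Φ (τ, x)) (Φ (τ, x)) := by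
    have h : Continuous fun x ↦ Φ (τ, x) := continuous_iff_continuousAt.2 fun x ↦
      (hΦ (τ, x) ⟨⟨by linarith [hτ.1, hτ.2], hτ.2⟩, mem_univ _⟩).continuousAt.comp
        (Continuous.prodMk_right τ).continuousAt
    exact continuous_const.mul ((b.continuous.comp h).clm_apply h)
  have hnn : ∀ x, 0 ≤ Real.exp (-K * τ) * b (Φ (τ, x)) (Φ (τ, x)) := fun x ↦
    mul_nonneg (Real.exp_pos _).le (hbnn _)
  have hzero := (setIntegral_eq_zero_iff_of_nonneg_ae (Filter.Eventually.of_forall hnn)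
    (hcont.continuousOn.integrableOn_Icc (μ := volume))).1
    (le_antisymm (hflux ▸ hneg) (integral_nonneg hnn))
  have hcl : Icc x₀ (fun j ↦ x₀ j + L) ⊆ closure (interior (Icc x₀ fun j ↦ x₀ j + L)) := by
    rw [← pi_univ_Icc, interior_pi_set finite_univ, closure_pi_set]
    refine pi_mono fun j _ ↦ ?_
    rw [closure_interior_Icc (by linarith)]
  have := Measure.eqOn_of_ae_eq hzero hcont.continuousOn continuousOn_const hcl
    (left_mem_Icc.2 fun j ↦ by linarith : x₀ ∈ _)
  by_contra hne
  exact (mul_pos (Real.exp_pos (-K * τ)) (hpos _ hne)).ne' this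

/-- A space-periodic solution with zero initial data of a linear symmetric hyperbolic system
vanishes. -/
theorem symmetric_hyperbolic_eq_zero [FiniteDimensional ℝ E]
    (b : E →L[ℝ] E →L[ℝ] ℝ) (hsymm : ∀ u v, b u v = b v u) (hpos : ∀ v, v ≠ 0 → 0 < b v v)
    (A : Fin d → E →L[ℝ] E) (hA : ∀ j u v, b (A j u) v = b u (A j v))
    {T L : ℝ} (hL : 0 < L) (B : ℝ × (Fin d → ℝ) → E →L[ℝ] E)
    (hB : ContinuousOn B (Ioo (-T) T ×ˢ univ)) (Φ : ℝ × (Fin d → ℝ) → E)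
    (hΦ : ∀ p ∈ Ioo (-T) T ×ˢ univ, DifferentiableAt ℝ Φ p)
    (hper : ∀ t x j, Φ (t, x + Pi.single j L) = Φ (t, x))
    (hpde : ∀ p ∈ Ioo (-T) T ×ˢ univ,
      fderiv ℝ Φ p (1, 0) = -∑ j, A j (fderiv ℝ Φ p (0, Pi.single j 1)) + B p (Φ p))
    (h0 : ∀ x, Φ (0, x) = 0) : ∀ p ∈ Ioo (-T) T ×ˢ univ, Φ p = 0 := by
  rintro ⟨t, x⟩ ⟨ht, -⟩
  rcases le_total 0 t with h | h
  · exact symmetric_hyperbolic_eq_zero_of_nonneg b hsymm hpos A hA hL B hB Φ hΦ hper hpde h0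
      ⟨h, ht.2⟩ x
  let r : ℝ × (Fin d → ℝ) →L[ℝ] ℝ × (Fin d → ℝ) :=
    (-ContinuousLinearMap.fst ℝ _ _).prod (ContinuousLinearMap.snd ℝ _ _)
  have hr : MapsTo r (Ioo (-T) T ×ˢ univ) (Ioo (-T) T ×ˢ univ) := fun p hp ↦
    ⟨⟨by simpa [r] using hp.1.2, by simpa [r] using neg_lt.1 hp.1.1⟩, mem_univ _⟩
  have hd : ∀ p ∈ Ioo (-T) T ×ˢ univ,
      HasFDerivAt (fun p ↦ Φ (r p)) ((fderiv ℝ Φ (r p)).comp r) p := fun p hp ↦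
    (hΦ _ (hr hp)).hasFDerivAt.comp p r.hasFDerivAt
  have := symmetric_hyperbolic_eq_zero_of_nonneg (τ := -t) b hsymm hpos (fun j ↦ -A j)
    (fun j u v ↦ by simp [hA]) hL (fun p ↦ -B (r p))
    (hB.comp r.continuous.continuousOn hr).neg (fun p ↦ Φ (r p))
    (fun p hp ↦ (hd p hp).differentiableAt) (fun t x j ↦ hper (-t) x j) (fun p hp ↦ ?_)
    (fun x ↦ by simpa [r] using h0 x) ⟨by linarith, by linarith [ht.1]⟩ x
  · simpa [r] using this
  · have h1 : r (1, 0) = -(1, 0) := by ext <;> simp [r]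
    have h2 : ∀ j : Fin d, r (0, Pi.single j 1) = (0, Pi.single j 1) := fun j ↦ by
      ext <;> simp [r]
    rw [(hd p hp).fderiv]
    simp only [ContinuousLinearMap.comp_apply, h1, h2, map_neg, hpde _ (hr hp), _root_.neg_apply,
      Finset.sum_neg_distrib]
    abel

end Hyperbolic

section Dirac

variable {d d0 : ℕ} {γ : Fin (d + 1) → Matrix (Fin d0) (Fin d0) ℂ}

namespace IsDiracFamily

theorem zero_mul_self (hγ : IsDiracFamily d d0 γ) : γ 0 * γ 0 = 1 := by
  have h := hγ 0 0
  rw [← two_smul ℂ (γ 0 * γ 0)] at h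
  have := congrArg (fun M ↦ (2⁻¹ : ℂ) • M) h
  simpa [eta, smul_smul] using this

theorem succ_mul_self (hγ : IsDiracFamily d d0 γ) (j : Fin d) : γ j.succ * γ j.succ = -1 := by
  have h := hγ j.succ j.succ
  rw [← two_smul ℂ (γ j.succ * γ j.succ)] at h
  have := congrArg (fun M ↦ (2⁻¹ : ℂ) • M) h
  simpa [eta, smul_smul] using this

theorem mul_comm_of_ne (hγ : IsDiracFamily d d0 γ) {μ ν : Fin (d + 1)} (h : μ ≠ ν) :
    γ μ * γ ν = -(γ ν * γ μ) := by
  have := hγ μ ν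
  rw [eta, if_neg h] at this
  exact eq_neg_of_add_eq_zero_left (by simpa using this)

theorem zero_mul_succ_mul_zero_mul_succ (hγ : IsDiracFamily d d0 γ) (j k : Fin d) :
    γ 0 * γ j.succ * (γ 0 * γ k.succ) = -(γ j.succ * γ k.succ) := by
  rw [hγ.mul_comm_of_ne (Fin.succ_ne_zero j).symm, neg_mul, mul_assoc, ← mul_assoc (γ 0) (γ 0),
    hγ.zero_mul_self, one_mul]

/-- The square of the Dirac operator is the d'Alembertian. -/
theorem sum_sum_mulVec (hγ : IsDiracFamily d d0 γ) (X : Fin (d + 1) → Fin (d + 1) → Fin d0 → ℂ)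
    (hX : ∀ μ ν, X μ ν = X ν μ) :
    ∑ ν, γ ν *ᵥ ∑ μ, γ μ *ᵥ X ν μ = X 0 0 - ∑ j : Fin d, X j.succ j.succ := by
  have h1 : ∑ ν, γ ν *ᵥ ∑ μ, γ μ *ᵥ X ν μ = ∑ ν, ∑ μ, (γ ν * γ μ) *ᵥ X ν μ := by
    simp [Matrix.mulVec_sum, Matrix.mulVec_mulVec]
  have h2 : ∑ ν, ∑ μ, (γ ν * γ μ) *ᵥ X ν μ = ∑ ν, ∑ μ, (γ μ * γ ν) *ᵥ X ν μ := by
    rw [Finset.sum_comm]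
    simp only [hX]
  have h3 : (2 : ℂ) • ∑ ν, ∑ μ, (γ ν * γ μ) *ᵥ X ν μ =
      (2 : ℂ) • (X 0 0 - ∑ j : Fin d, X j.succ j.succ) := by
    rw [two_smul]
    nth_rw 2 [h2]
    simp only [← Finset.sum_add_distrib, ← Matrix.add_mulVec, hγ _ _, Matrix.smul_mulVec,
      Matrix.one_mulVec]
    have h4 : ∀ ν, ∑ μ, ((2 * eta d ν μ : ℝ) : ℂ) • X ν μ =
        ((2 * eta d ν ν : ℝ) : ℂ) • X ν ν := fun ν ↦
      Finset.sum_eq_single ν (fun μ _ h ↦ by simp [eta, h.symm]) (by simp)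
    simp only [h4, Fin.sum_univ_succ]
    simp [eta, Finset.smul_sum, sub_eq_add_neg]
  rw [h1]
  exact smul_right_injective _ two_ne_zero h3

end IsDiracFamily

/-- The residual of the Dirac equation. -/
def diracResidual (d d0 : ℕ) (γ : Fin (d + 1) → Matrix (Fin d0) (Fin d0) ℂ) (m : ℝ)
    (F : (Fin d0 → ℂ) → Fin d0 → ℂ) (ψ : ℝ × (Fin d → ℝ) → Fin d0 → ℂ) (p : ℝ × (Fin d → ℝ)) :
    Fin d0 → ℂ :=
  (-Complex.I) • (γ 0 *ᵥ ptderiv d d0 ψ p + ∑ j : Fin d, γ j.succ *ᵥ pxderiv d d0 j ψ p)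
    + (m : ℂ) • ψ p - F (ψ p)

/-- Multiplication by a complex matrix as a real-linear continuous map. -/
def realMulVecCLM (M : Matrix (Fin d0) (Fin d0) ℂ) : (Fin d0 → ℂ) →L[ℝ] (Fin d0 → ℂ) :=
  (LinearMap.toContinuousLinearMap M.mulVecLin).restrictScalars ℝ

@[simp]
theorem realMulVecCLM_apply (M : Matrix (Fin d0) (Fin d0) ℂ) (v : Fin d0 → ℂ) :
    realMulVecCLM M v = M *ᵥ v := rfl

/-- The pointwise algebra behind the evolution equation of the Dirac residual: `X` stands for the
second derivatives, `D` for the first derivatives, `a` for the value of the field. -/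
theorem IsDiracFamily.residual_evolution (hγ : IsDiracFamily d d0 γ) (m : ℂ)
    (N : Matrix (Fin d0) (Fin d0) ℂ) (X : Fin (d + 1) → Fin (d + 1) → Fin d0 → ℂ)
    (hX : ∀ μ ν, X μ ν = X ν μ) (D : Fin (d + 1) → Fin d0 → ℂ) (a f : Fin d0 → ℂ)
    (hKG : X 0 0 - ∑ j : Fin d, X j.succ j.succ + m ^ 2 • a =
      m • f + Complex.I • ∑ j : Fin d, (γ j.succ * N) *ᵥ D j.succ
        - Complex.I • ∑ j : Fin d, (γ 0 * N * γ 0 * γ j.succ) *ᵥ D j.succ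
        + m • (γ 0 * N * γ 0) *ᵥ a - (γ 0 * N * γ 0) *ᵥ f)
    (P : Fin (d + 1) → Fin d0 → ℂ)
    (hP : ∀ ν, P ν = (-Complex.I) • ∑ μ, γ μ *ᵥ X ν μ + m • D ν - N *ᵥ D ν) :
    P 0 = -∑ j : Fin d, (γ 0 * γ j.succ) *ᵥ P j.succ +
      (Complex.I • (m • γ 0 - N * γ 0)) *ᵥ
        ((-Complex.I) • (γ 0 *ᵥ D 0 + ∑ j : Fin d, γ j.succ *ᵥ D j.succ) + m • a - f) := by
  have h00 : ∀ v, γ 0 *ᵥ (γ 0 *ᵥ v) = v := fun v ↦ by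
    rw [Matrix.mulVec_mulVec, hγ.zero_mul_self, Matrix.one_mulVec]
  have hsum : ∑ ν, γ ν *ᵥ P ν = (-Complex.I) • (X 0 0 - ∑ j : Fin d, X j.succ j.succ)
      + m • ∑ ν, γ ν *ᵥ D ν - ∑ ν, γ ν *ᵥ (N *ᵥ D ν) := by
    rw [← hγ.sum_sum_mulVec X hX]
    simp only [hP, Matrix.mulVec_sub, Matrix.mulVec_add, Matrix.mulVec_smul,
      Finset.sum_add_distrib, Finset.sum_sub_distrib, ← Finset.smul_sum]
  rw [eq_sub_of_add_eq hKG] at hsum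
  have hinj := congrArg (γ 0 *ᵥ ·) hsum
  simp only [Fin.sum_univ_succ, Matrix.mulVec_add, Matrix.mulVec_sub, Matrix.mulVec_smul,
    ← Matrix.mulVec_mulVec, ← Matrix.mulVec_sum, h00] at hinj ⊢
  rw [eq_sub_of_add_eq hinj]
  simp only [Matrix.smul_mulVec, Matrix.sub_mulVec, ← Matrix.mulVec_mulVec, h00]
  match_scalars <;> ring_nf <;> simp only [Complex.I_sq] <;> ring

theorem differentiableAt_diracResidual_and_fderiv_apply {m : ℝ} {F : (Fin d0 → ℂ) → Fin d0 → ℂ}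
    {F' : (Fin d0 → ℂ) → Matrix (Fin d0) (Fin d0) ℂ}
    (hF : ∀ u : Fin d0 → ℂ,
      HasFDerivAt F (LinearMap.toContinuousLinearMap (Matrix.mulVecLin (F' u))) u)
    {ψ : ℝ × (Fin d → ℝ) → Fin d0 → ℂ} {p : ℝ × (Fin d → ℝ)} (hψ : ContDiffAt ℝ 2 ψ p) :
    DifferentiableAt ℝ (diracResidual d d0 γ m F ψ) p ∧ ∀ v,
      fderiv ℝ (diracResidual d d0 γ m F ψ) p v =
        (-Complex.I) • (γ 0 *ᵥ fderiv ℝ (fderiv ℝ ψ) p v (1, 0) +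
          ∑ j : Fin d, γ j.succ *ᵥ fderiv ℝ (fderiv ℝ ψ) p v (0, Pi.single j 1))
        + (m : ℂ) • fderiv ℝ ψ p v - F' (ψ p) *ᵥ fderiv ℝ ψ p v := by
  have h1 : HasFDerivAt ψ (fderiv ℝ ψ p) p := (hψ.differentiableAt (by simp)).hasFDerivAt
  have h2 : HasFDerivAt (fderiv ℝ ψ) (fderiv ℝ (fderiv ℝ ψ) p) p :=
    ((hψ.fderiv_right (m := 1) (by norm_num)).differentiableAt (by simp)).hasFDerivAt
  have h3 : ∀ M : Matrix (Fin d0) (Fin d0) ℂ, ∀ w, HasFDerivAt (fun q ↦ M *ᵥ fderiv ℝ ψ q w)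
      ((realMulVecCLM M).comp ((fderiv ℝ (fderiv ℝ ψ) p).flip w)) p := fun M w ↦
    (realMulVecCLM M).hasFDerivAt.comp p
      ((ContinuousLinearMap.apply ℝ (Fin d0 → ℂ) w).hasFDerivAt.comp p h2)
  have h := (((((h3 (γ 0) (1, 0)).add (HasFDerivAt.fun_sum (u := Finset.univ)
    fun j _ ↦ h3 (γ (Fin.succ j)) (0, Pi.single j 1)))).const_smul (-Complex.I)).add
      (h1.const_smul (m : ℂ))).sub (((hF (ψ p)).restrictScalars ℝ).comp p h1)
  refine ⟨h.differentiableAt, fun v ↦ ?_⟩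
  have h' : HasFDerivAt (diracResidual d d0 γ m F ψ) _ p := h
  rw [h'.fderiv]
  simp

end Dirac

/-- a `C²`, spatially `2π`-periodic solution of the Klein–Gordon type equation
`∂²ψ/∂t² − Δψ + m²ψ = G(ψ, ∂ψ)` with the Dirac-compatible initial data
`ψ(0,·) = ψ₀`, `∂ψ/∂t(0,·) = −γ⁰ Σ γʲ ∂ψ₀/∂xʲ − i m γ⁰ ψ₀ + i γ⁰ F(ψ₀)`
solves the Dirac equation `-i Σ_μ γ^μ ∂ψ/∂x^μ + m ψ = F(ψ)` pointwise on `(-T,T) × ℝᵈ`. -/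
theorem klein_gordon_implies_dirac (d : ℕ) (hd : 1 ≤ d) (d0 : ℕ)
    (hd0 : d0 = 2 ^ ((d + 1) / 2))
    (γ : Fin (d + 1) → Matrix (Fin d0) (Fin d0) ℂ) (hγ : IsDiracFamily d d0 γ)
    (m : ℝ) (hm : 0 < m) (T : ℝ) (hT : 0 < T)
    (F : (Fin d0 → ℂ) → Fin d0 → ℂ) (F' : (Fin d0 → ℂ) → Matrix (Fin d0) (Fin d0) ℂ)
    (hF : ∀ u : Fin d0 → ℂ,
      HasFDerivAt F (LinearMap.toContinuousLinearMap (Matrix.mulVecLin (F' u))) u)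
    (ψ : ℝ × (Fin d → ℝ) → Fin d0 → ℂ)
    (hψ : ContDiffOn ℝ 2 ψ (Set.Ioo (-T) T ×ˢ (Set.univ : Set (Fin d → ℝ))))
    (hper : ∀ t : ℝ, ∀ x : Fin d → ℝ, ∀ j : Fin d,
      ψ (t, x + Pi.single j (2 * Real.pi)) = ψ (t, x))
    (hKG : ∀ p ∈ Set.Ioo (-T) T ×ˢ (Set.univ : Set (Fin d → ℝ)),
      ptderiv d d0 (ptderiv d d0 ψ) p
          - (∑ j : Fin d, pxderiv d d0 j (pxderiv d d0 j ψ) p)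
          + (((m : ℂ)) ^ 2) • ψ p
        = GTerm d d0 γ m F F' ψ p)
    (ψ₀ : (Fin d → ℝ) → Fin d0 → ℂ)
    (hinit0 : ∀ x : Fin d → ℝ, ψ (0, x) = ψ₀ x)
    (hinit1 : ∀ x : Fin d → ℝ,
      ptderiv d d0 ψ (0, x)
        = -(γ 0).mulVec (∑ j : Fin d, (γ j.succ).mulVec (fderiv ℝ ψ₀ x (Pi.single j 1)))
          - (Complex.I * (m : ℂ)) • (γ 0).mulVec (ψ₀ x)
          + Complex.I • (γ 0).mulVec (F (ψ₀ x))) :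
    ∀ p ∈ Set.Ioo (-T) T ×ˢ (Set.univ : Set (Fin d → ℝ)),
      (-Complex.I) • ((γ 0).mulVec (ptderiv d d0 ψ p)
          + ∑ j : Fin d, (γ j.succ).mulVec (pxderiv d d0 j ψ p))
        + (m : ℂ) • ψ p = F (ψ p) := by
  have hΩ : IsOpen (Set.Ioo (-T) T ×ˢ (Set.univ : Set (Fin d → ℝ))) := isOpen_Ioo.prod isOpen_univ
  have hψat : ∀ p ∈ Set.Ioo (-T) T ×ˢ (Set.univ : Set (Fin d → ℝ)), ContDiffAt ℝ 2 ψ p :=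
    fun p hp ↦ hψ.contDiffAt (hΩ.mem_nhds hp)
  have hFd : Differentiable ℂ F := fun u ↦ (hF u).differentiableAt
  obtain ⟨b, hsymm, hpos, hA⟩ := exists_bilin_symmetric_of_anticommuting
    (fun j : Fin d ↦ realMulVecCLM (γ 0 * γ j.succ))
    (fun j v ↦ by
      simp [-Matrix.mulVec_mulVec, Matrix.mulVec_mulVec v, hγ.zero_mul_succ_mul_zero_mul_succ,
        hγ.succ_mul_self])
    (fun j k hjk v ↦ by
      simp [Matrix.mulVec_mulVec, hγ.zero_mul_succ_mul_zero_mul_succ, Matrix.neg_mulVec,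
        hγ.mul_comm_of_ne ((Fin.succ_injective d).ne hjk)])
  have hres := symmetric_hyperbolic_eq_zero b hsymm hpos _ hA (T := T) Real.two_pi_pos
    (fun p ↦ realMulVecCLM (Complex.I • ((m : ℂ) • γ 0 - F' (ψ p) * γ 0))) ?_
    (diracResidual d d0 γ m F ψ)
    (fun p hp ↦ (differentiableAt_diracResidual_and_fderiv_apply hF (hψat p hp)).1) ?_ ?_ ?_
  · exact fun p hp ↦ sub_eq_zero.1 (hres p hp)
  · refine continuousOn_clm_apply.2 fun v ↦ ?_
    have h1 : ContinuousOn (fun p ↦ fderiv ℂ F (ψ p) (γ 0 *ᵥ v)) (Set.Ioo (-T) T ×ˢ Set.univ) :=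
      ((continuous_fderiv_of_differentiable_complex hFd).comp_continuousOn
        hψ.continuousOn).clm_apply continuousOn_const
    have h2 : ∀ p, realMulVecCLM (Complex.I • ((m : ℂ) • γ 0 - F' (ψ p) * γ 0)) v =
        Complex.I • ((m : ℂ) • γ 0 *ᵥ v - fderiv ℂ F (ψ p) (γ 0 *ᵥ v)) := fun p ↦ by
      simp [(hF (ψ p)).fderiv, Matrix.smul_mulVec, Matrix.sub_mulVec]
    simp_rw [h2]
    exact (continuousOn_const.sub h1).const_smul Complex.I
  · intro t x j
    have hfun : (fun q ↦ ψ (q + (0, Pi.single j (2 * Real.pi)))) = ψ := by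
      ext1 ⟨t, x⟩
      simpa using hper t x j
    have hfd : fderiv ℝ ψ (t, x + Pi.single j (2 * Real.pi)) = fderiv ℝ ψ (t, x) := by
      have h := fderiv_comp_add_right (𝕜 := ℝ) (f := ψ) (x := (t, x))
        ((0, Pi.single j (2 * Real.pi)) : ℝ × (Fin d → ℝ))
      rw [hfun] at h
      simpa using h.symm
    simp only [diracResidual, ptderiv, pxderiv, hfd, hper]
  · intro p hp
    obtain ⟨-, hfd⟩ := differentiableAt_diracResidual_and_fderiv_apply (γ := γ) (m := m) hF
      (hψat p hp)
    have hsnd : DifferentiableAt ℝ (fderiv ℝ ψ) p :=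
      ((hψat p hp).fderiv_right (m := 1) (by norm_num)).differentiableAt (by simp)
    have hsymm2 := (hψat p hp).isSymmSndFDerivAt (by simp)
    have hdd : ∀ v w, fderiv ℝ (fun q ↦ fderiv ℝ ψ q v) p w = fderiv ℝ (fderiv ℝ ψ) p w v :=
      fun v w ↦ by
        have h : HasFDerivAt (fun q ↦ fderiv ℝ ψ q v)
            ((ContinuousLinearMap.apply ℝ (Fin d0 → ℂ) v).comp (fderiv ℝ (fderiv ℝ ψ) p)) p :=
          (ContinuousLinearMap.apply ℝ (Fin d0 → ℂ) v).hasFDerivAt.comp p hsnd.hasFDerivAt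
        rw [h.fderiv]
        rfl
    let e : Fin (d + 1) → ℝ × (Fin d → ℝ) := Fin.cons (1, 0) fun j ↦ (0, Pi.single j 1)
    have hKGp := hKG p hp
    have h := hγ.residual_evolution m (F' (ψ p)) (fun ν μ ↦ fderiv ℝ (fderiv ℝ ψ) p (e ν) (e μ))
      (fun μ ν ↦ hsymm2 _ _) (fun μ ↦ fderiv ℝ ψ p (e μ)) (ψ p) (F (ψ p))
      (by
        unfold ptderiv pxderiv GTerm pxderiv at hKGp
        simpa [e, hdd] using hKGp)
      (fun ν ↦ fderiv ℝ (diracResidual d d0 γ m F ψ) p (e ν))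
      (fun ν ↦ by simp only [hfd, Fin.sum_univ_succ]; rfl)
    exact h
  · intro x
    have hx : ((0, x) : ℝ × (Fin d → ℝ)) ∈ Set.Ioo (-T) T ×ˢ (Set.univ : Set (Fin d → ℝ)) :=
      ⟨⟨by linarith, hT⟩, trivial⟩
    have hψd := ((hψat _ hx).differentiableAt (by simp)).hasFDerivAt
    have hψ₀ : HasFDerivAt ψ₀ ((fderiv ℝ ψ (0, x)).comp (ContinuousLinearMap.inr ℝ ℝ _)) x := by
      rw [← funext hinit0]
      exact hψd.comp x (hasFDerivAt_prodMk_right (0 : ℝ) x)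
    have hpx : ∀ j, fderiv ℝ ψ₀ x (Pi.single j 1) = pxderiv d d0 j ψ (0, x) := fun j ↦ by
      rw [hψ₀.fderiv]; rfl
    have h00 : ∀ v, γ 0 *ᵥ (γ 0 *ᵥ v) = v := fun v ↦ by
      rw [Matrix.mulVec_mulVec, hγ.zero_mul_self, Matrix.one_mulVec]
    simp only [diracResidual, hinit1, hpx, hinit0, Matrix.mulVec_add, Matrix.mulVec_sub,
      Matrix.mulVec_neg, Matrix.mulVec_smul, h00]
    match_scalars <;> ring_nf <;> simp

end
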